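/- Let p ∈ (0,1) and let (G_t)_{t≥1} be the preferential attachment process with edge-steps with parameter p, and set c_p = 1 − p/2. Then for every ε > 0 there exist positive constants C₁′, C₂′ and δ′, depending only on ε and p, such that for all t, P( there exists a vertex j of G_t with Γ_t(j) ≥ C₁′ · t^{c_p(1−ε)} ) ≥ 1 − C₂′ · t^{−δ′}, where Γ_t(j) denotes the number of distinct neighbors of vertex j in G_t. -/

import Mathlib

open MeasureTheory Filter

attribute [local instance] Classical.propDecidable

/-- Degree of vertex `i` at time `t` computed from the endpoint process `ep`:
the edge added at step `s` contributes `1` for each of its endpoints equal to `i`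
(so a loop at `i` contributes `2`). -/
noncomputable def degOf {Ω : Type} (ep : ℕ → Ω → ℕ × ℕ) (t i : ℕ) (ω : Ω) : ℕ :=
  ∑ s ∈ Finset.Icc 1 t,
    ((if (ep s ω).1 = i then 1 else 0) + (if (ep s ω).2 = i then 1 else 0))

/-- The preferential attachment random graph process with edge-steps and parameter `p`.
`G_1` is a single vertex (labeled `1`) with a loop.  At each step `t + 1` (for `t ≥ 1`),
with probability `p` a vertex-step occurs: a new vertex `nv t + 1` is added together with an
edge to an old vertex `u`, chosen with probability `d_t(u) / (2t)`; with probability `1 - p`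
an edge-step occurs: an edge `{u, w}` is added, where `u` and `w` are chosen independently,
each with probability proportional to its degree.  The field `ep t` records the (ordered pair
of) endpoints of the unique edge added at step `t`, `nv t` is the number of vertices of `G_t`,
and `Z t` tells whether step `t` was a vertex-step.  The one-step conditional laws are
prescribed via conditional expectations with respect to a filtration `ℱ` to which the process
is adapted. -/
structure PAProcess (p : ℝ) where
  Ω : Type
  m0 : MeasurableSpace Ω
  μ : Measure Ω
  isProb : IsProbabilityMeasure μ
  ℱ : Filtration ℕ m0
  Z : ℕ → Ω → Bool
  nv : ℕ → Ω → ℕ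
  ep : ℕ → Ω → ℕ × ℕ
  nv_one : ∀ ω, nv 1 ω = 1
  ep_one : ∀ ω, ep 1 ω = (1, 1)
  nv_succ : ∀ t, 1 ≤ t → ∀ ω, nv (t + 1) ω = nv t ω + (if Z (t + 1) ω then 1 else 0)
  ep_vertexStep : ∀ t, 1 ≤ t → ∀ ω, Z (t + 1) ω = true →
    (ep (t + 1) ω).2 = nv t ω + 1 ∧ 1 ≤ (ep (t + 1) ω).1 ∧ (ep (t + 1) ω).1 ≤ nv t ω
  ep_edgeStep : ∀ t, 1 ≤ t → ∀ ω, Z (t + 1) ω = false →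
    1 ≤ (ep (t + 1) ω).1 ∧ (ep (t + 1) ω).1 ≤ nv t ω ∧
    1 ≤ (ep (t + 1) ω).2 ∧ (ep (t + 1) ω).2 ≤ nv t ω
  Z_meas : ∀ t, Measurable[ℱ t] (Z t)
  nv_meas : ∀ t, Measurable[ℱ t] (nv t)
  ep_meas : ∀ t, Measurable[ℱ t] (ep t)
  condLaw_Z : ∀ t, 1 ≤ t →
    μ[Set.indicator {ω | Z (t + 1) ω = true} (fun _ => (1 : ℝ)) | ℱ t] =ᵐ[μ] fun _ => p
  condLaw_vertex : ∀ t, 1 ≤ t → ∀ u,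
    μ[Set.indicator {ω | Z (t + 1) ω = true ∧ ep (t + 1) ω = (u, nv t ω + 1)}
        (fun _ => (1 : ℝ)) | ℱ t]
      =ᵐ[μ] fun ω => p * (degOf ep t u ω : ℝ) / (2 * t)
  condLaw_edge : ∀ t, 1 ≤ t → ∀ u w,
    μ[Set.indicator {ω | Z (t + 1) ω = false ∧ ep (t + 1) ω = (u, w)}
        (fun _ => (1 : ℝ)) | ℱ t]
      =ᵐ[μ] fun ω => (1 - p) * (degOf ep t u ω : ℝ) * (degOf ep t w ω : ℝ) / (2 * t) ^ 2

namespace PAProcess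

variable {p : ℝ} (P : PAProcess p)

/-- degree `d_t(i)` of vertex `i` in `G_t` (`0` if `i` is not yet present). -/
noncomputable def deg (t i : ℕ) (ω : P.Ω) : ℕ := degOf P.ep t i ω

/-- `i` and `j` are joined by at least one edge in `G_t`. -/
def Joined (t i j : ℕ) (ω : P.Ω) : Prop :=
  ∃ s ∈ Finset.Icc 1 t, P.ep s ω = (i, j) ∨ P.ep s ω = (j, i)

/-- number of triangles of `G_t`: sets of three distinct vertices pairwise joined by at
least one edge (counted without edge multiplicities). -/
noncomputable def triangles (t : ℕ) (ω : P.Ω) : ℕ :=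
  ((Finset.Icc 1 t ×ˢ Finset.Icc 1 t ×ˢ Finset.Icc 1 t).filter
    (fun q => q.1 < q.2.1 ∧ q.2.1 < q.2.2 ∧ P.Joined t q.1 q.2.1 ω ∧
      P.Joined t q.1 q.2.2 ω ∧ P.Joined t q.2.1 q.2.2 ω)).card

/-- number of cherries (paths of length 2) of `G_t`: unordered pairs of distinct edges of
`G_t` sharing a common endpoint.  The edges of `G_t` are indexed by their creation times
`1 ≤ s ≤ t`. -/
noncomputable def cherries (t : ℕ) (ω : P.Ω) : ℕ :=
  ((Finset.Icc 1 t ×ˢ Finset.Icc 1 t).filter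
    (fun q => q.1 < q.2 ∧
      ((P.ep q.1 ω).1 = (P.ep q.2 ω).1 ∨ (P.ep q.1 ω).1 = (P.ep q.2 ω).2 ∨
       (P.ep q.1 ω).2 = (P.ep q.2 ω).1 ∨ (P.ep q.1 ω).2 = (P.ep q.2 ω).2))).card

/-- global clustering coefficient of `G_t`. -/
noncomputable def clustering (t : ℕ) (ω : P.Ω) : ℝ :=
  3 * (P.triangles t ω : ℝ) / (P.cherries t ω : ℝ)

/-- clique number of `G_t`: the largest `k` such that `G_t` contains `k` distinct vertices
pairwise joined by at least one edge. -/
noncomputable def cliqueNum (t : ℕ) (ω : P.Ω) : ℕ :=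
  sSup {k | ∃ S : Finset ℕ, S ⊆ Finset.Icc 1 (P.nv t ω) ∧ S.card = k ∧
    ∀ i ∈ S, ∀ j ∈ S, i ≠ j → P.Joined t i j ω}

/-- `Γ_t(j)`: the number of distinct vertices joined to `j` by at least one edge in `G_t`. -/
noncomputable def nbrCount (t j : ℕ) (ω : P.Ω) : ℕ :=
  ((Finset.Icc 1 t).filter (fun i => P.Joined t i j ω)).card

/-- the time at which vertex `j` is added to the graph. -/
noncomputable def addTime (j : ℕ) (ω : P.Ω) : ℕ := sInf {t | P.nv t ω = j}

/-- at step `s` an edge joining `i` and `j` is added by an edge-step. -/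
def EdgeStepEdge (s i j : ℕ) (ω : P.Ω) : Prop :=
  2 ≤ s ∧ P.Z s ω = false ∧ (P.ep s ω = (i, j) ∨ P.ep s ω = (j, i))

/-- at step `s` an edge joining `i` and `j` is added by a vertex-step. -/
def VertexStepEdge (s i j : ℕ) (ω : P.Ω) : Prop :=
  2 ≤ s ∧ P.Z s ω = true ∧ (P.ep s ω = (i, j) ∨ P.ep s ω = (j, i))

/-- at step `s` vertex `j` is added by a vertex-step and its attaching edge connects it
to vertex `i`. -/
def AttachEdge (s i j : ℕ) (ω : P.Ω) : Prop :=
  2 ≤ s ∧ P.Z s ω = true ∧ P.ep s ω = (i, j) ∧ P.nv s ω = j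

/-- `i` and `j` are joined in `G_t` by at least one edge created at an edge-step. -/
def EdgeJoined (t i j : ℕ) (ω : P.Ω) : Prop :=
  ∃ s ∈ Finset.Icc 1 t, P.EdgeStepEdge s i j ω

/-- `i` and `j` are joined in `G_t` by at least one edge created at a vertex-step. -/
def VJoined (t i j : ℕ) (ω : P.Ω) : Prop :=
  ∃ s ∈ Finset.Icc 1 t, P.VertexStepEdge s i j ω

/-- `i` and `j` are joined in `G_t`, and exclusively by edges created at vertex-steps. -/
def OnlyVertexJoined (t i j : ℕ) (ω : P.Ω) : Prop :=
  P.Joined t i j ω ∧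
    ∀ s ∈ Finset.Icc 1 t, (P.ep s ω = (i, j) ∨ P.ep s ω = (j, i)) → P.Z s ω = true

end PAProcess

theorem integral_mul_indicator_of_condExp {Ω : Type*} {m m0 : MeasurableSpace Ω} {μ : Measure Ω}
    [IsProbabilityMeasure μ] (hm : m ≤ m0) {f q : Ω → ℝ} {B : Set Ω} {C : ℝ}
    (hf : Measurable[m] f) (hC : ∀ ω, |f ω| ≤ C) (hB : MeasurableSet B)
    (hq : μ[B.indicator (fun _ => (1 : ℝ)) | m] =ᵐ[μ] q) :
    ∫ ω, f ω * B.indicator (fun _ => (1 : ℝ)) ω ∂μ = ∫ ω, f ω * q ω ∂μ := by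
  have hint : Integrable (B.indicator (fun _ => (1 : ℝ))) μ :=
    (integrable_const (1 : ℝ)).indicator hB
  have hfi : Integrable (f * B.indicator (fun _ => (1 : ℝ))) μ :=
    hint.bdd_mul (c := C) (hf.mono hm le_rfl).aestronglyMeasurable
      (Eventually.of_forall fun ω => by simpa using hC ω)
  have h := condExp_mul_of_stronglyMeasurable_left (μ := μ) hf.stronglyMeasurable hfi hint
  have h2 := integral_condExp (μ := μ) (f := f * B.indicator (fun _ => (1 : ℝ))) hm
  calc ∫ ω, f ω * B.indicator (fun _ => (1 : ℝ)) ω ∂μ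
      = ∫ ω, (μ[f * B.indicator (fun _ => (1 : ℝ)) | m]) ω ∂μ := h2.symm
    _ = ∫ ω, f ω * q ω ∂μ := by
      refine integral_congr_ae ?_
      filter_upwards [h, hq] with ω h1 h3
      rw [h1, Pi.mul_apply, h3]

namespace PAProcess

attribute [local instance] PAProcess.m0 PAProcess.isProb

variable {p : ℝ} (P : PAProcess p)

section Deterministic

theorem one_le_nv {t : ℕ} (ht : 1 ≤ t) (ω : P.Ω) : 1 ≤ P.nv t ω := by
  induction t, ht using Nat.le_induction with
  | base => simp [P.nv_one]
  | succ t ht ih => rw [P.nv_succ t ht]; omega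

theorem nv_le {t : ℕ} (ht : 1 ≤ t) (ω : P.Ω) : P.nv t ω ≤ t := by
  induction t, ht using Nat.le_induction with
  | base => simp [P.nv_one]
  | succ t ht ih => rw [P.nv_succ t ht]; split_ifs <;> omega

theorem nv_mono {s t : ℕ} (hs : 1 ≤ s) (hst : s ≤ t) (ω : P.Ω) : P.nv s ω ≤ P.nv t ω := by
  induction t, hst using Nat.le_induction with
  | base => rfl
  | succ t ht ih => rw [P.nv_succ t (hs.trans ht)]; omega

theorem ep_mem_Icc {t : ℕ} (ht : 1 ≤ t) (ω : P.Ω) :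
    (P.ep t ω).1 ∈ Finset.Icc 1 t ∧ (P.ep t ω).2 ∈ Finset.Icc 1 t := by
  obtain rfl | ht' := ht.eq_or_lt
  · simp [P.ep_one]
  · obtain ⟨s, rfl⟩ : ∃ s, t = s + 1 := ⟨t - 1, by omega⟩
    have hs : 1 ≤ s := by omega
    have h1 := P.nv_le hs ω
    simp only [Finset.mem_Icc]
    cases hZ : P.Z (s + 1) ω
    · have := P.ep_edgeStep s hs ω hZ; omega
    · have := P.ep_vertexStep s hs ω hZ; omega

theorem sum_degOf (t : ℕ) (ω : P.Ω) : ∑ w ∈ Finset.Icc 1 t, degOf P.ep t w ω = 2 * t := by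
  unfold degOf
  rw [Finset.sum_comm]
  have h : ∀ s ∈ Finset.Icc 1 t, ∑ w ∈ Finset.Icc 1 t,
      ((if (P.ep s ω).1 = w then 1 else 0) + (if (P.ep s ω).2 = w then 1 else 0)) = 2 := by
    intro s hs
    rw [Finset.mem_Icc] at hs
    have := P.ep_mem_Icc hs.1 ω
    simp only [Finset.mem_Icc] at this
    rw [Finset.sum_add_distrib, Finset.sum_ite_eq, Finset.sum_ite_eq,
      if_pos (Finset.mem_Icc.2 (by omega)), if_pos (Finset.mem_Icc.2 (by omega))]
  rw [Finset.sum_congr rfl h]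
  simp [mul_comm]

theorem degOf_succ (t i : ℕ) (ω : P.Ω) : degOf P.ep (t + 1) i ω = degOf P.ep t i ω +
    ((if (P.ep (t + 1) ω).1 = i then 1 else 0) + (if (P.ep (t + 1) ω).2 = i then 1 else 0)) :=
  Finset.sum_Icc_succ_top (by omega) _

theorem degOf_mono (i : ℕ) (ω : P.Ω) : Monotone fun t => degOf P.ep t i ω :=
  monotone_nat_of_le_succ fun t => by rw [degOf_succ]; omega

theorem two_le_degOf_one {t : ℕ} (ht : 1 ≤ t) (ω : P.Ω) : 2 ≤ degOf P.ep t 1 ω :=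
  le_trans (by simp [degOf, P.ep_one]) (P.degOf_mono 1 ω ht)

theorem degOf_le (t i : ℕ) (ω : P.Ω) : degOf P.ep t i ω ≤ 2 * t := by
  induction t with
  | zero => simp [degOf]
  | succ t ih => rw [degOf_succ]; split_ifs <;> omega

/-- The event that step `s + 1` is a vertex-step attaching the new vertex to vertex `1`. -/
def attachOne (s : ℕ) : Set P.Ω :=
  {ω | P.Z (s + 1) ω = true ∧ P.ep (s + 1) ω = (1, P.nv s ω + 1)}

/-- The event that step `s + 1` is an edge-step with ordered endpoints `(u, w)`. -/
def edgeEvent (s u w : ℕ) : Set P.Ω :=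
  {ω | P.Z (s + 1) ω = false ∧ P.ep (s + 1) ω = (u, w)}

/-- The number of vertices attached to vertex `1` up to time `t`. -/
noncomputable def attachCount (t : ℕ) (ω : P.Ω) : ℝ :=
  ∑ s ∈ Finset.Ico 1 t, (P.attachOne s).indicator (fun _ => (1 : ℝ)) ω

theorem attachCount_le_nbrCount (t : ℕ) (ω : P.Ω) :
    P.attachCount t ω ≤ P.nbrCount t 1 ω := by
  have h : P.attachCount t ω = (((Finset.Ico 1 t).filter (fun s => ω ∈ P.attachOne s)).card : ℝ) := by
    simp [attachCount, Set.indicator_apply, Finset.sum_boole]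
  rw [h, Nat.cast_le]
  refine Finset.card_le_card_of_injOn (fun s => P.nv s ω + 1) ?_ ?_
  · intro s hs
    simp only [Finset.mem_coe, Finset.mem_filter, Finset.mem_Ico] at hs
    have := P.nv_le hs.1.1 ω
    simp only [Finset.mem_coe, Finset.mem_filter, Finset.mem_Icc]
    exact ⟨by omega, s + 1, by simp; omega, Or.inr hs.2.2⟩
  · have key : ∀ s s' : ℕ, 1 ≤ s → s < s' → ω ∈ P.attachOne s → P.nv s ω < P.nv s' ω := by
      intro s s' h1 hlt hs
      have h2 := P.nv_mono (s := s + 1) (by omega) hlt ω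
      have h3 := P.nv_succ s h1 ω
      rw [if_pos hs.1] at h3
      omega
    intro s hs s' hs' heq
    simp only [Finset.mem_coe, Finset.mem_filter, Finset.mem_Ico] at hs hs'
    simp only [add_left_inj] at heq
    rcases lt_trichotomy s s' with hlt | rfl | hlt
    · have := key s s' hs.1.1 hlt hs.2; omega
    · rfl
    · have := key s' s hs'.1.1 hlt hs'.2; omega

/-- The indicator that step `t + 1` joins vertex `1` to another vertex. -/
noncomputable def joinOne (t : ℕ) (ω : P.Ω) : ℝ :=
  (P.attachOne t).indicator (fun _ => (1 : ℝ)) ω +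
    ∑ w ∈ Finset.Icc 2 t, ((P.edgeEvent t 1 w).indicator (fun _ => (1 : ℝ)) ω +
      (P.edgeEvent t w 1).indicator (fun _ => (1 : ℝ)) ω)

theorem joinOne_cases {t : ℕ} (ω : P.Ω) : P.joinOne t ω = 0 ∨
    (P.joinOne t ω = 1 ∧ degOf P.ep t 1 ω + 1 ≤ degOf P.ep (t + 1) 1 ω) := by
  rw [degOf_succ]
  unfold joinOne
  simp only [Set.indicator_apply, attachOne, edgeEvent, Set.mem_ofPred_eq]
  rcases (P.Z (t + 1) ω).eq_false_or_eq_true.symm with hZ | hZ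
  · obtain ⟨a, b, hab⟩ : ∃ a b, P.ep (t + 1) ω = (a, b) := ⟨_, _, rfl⟩
    simp only [hZ, hab, Bool.false_eq_true, false_and, if_false, true_and, zero_add, Prod.mk.injEq]
    rw [Finset.sum_add_distrib]
    by_cases ha : a = 1 <;> by_cases hb : b = 1
    · left
      have : ∀ w ∈ Finset.Icc 2 t, ¬ (1 = w) := by
        intro w hw; rw [Finset.mem_Icc] at hw; omega
      subst ha hb
      rw [Finset.sum_eq_zero, Finset.sum_eq_zero, add_zero] <;>
      · intro w hw; simp [this w hw]
    · simp only [ha, hb, true_and, and_false, if_false, Finset.sum_const_zero,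
        Finset.sum_ite_eq]
      split_ifs <;> simp
    · simp only [ha, hb, false_and, and_true, if_false, Finset.sum_const_zero,
        Finset.sum_ite_eq]
      split_ifs <;> simp
    · left; simp [ha, hb]
  · by_cases h : P.ep (t + 1) ω = (1, P.nv t ω + 1)
    · right; simp [h, hZ]
    · left; simp [h, hZ]

theorem inv_degOf_succ_le {t : ℕ} (ht : 1 ≤ t) (ω : P.Ω) :
    1 / ((degOf P.ep (t + 1) 1 ω : ℝ) - 1) ≤ 1 / ((degOf P.ep t 1 ω : ℝ) - 1) -
      1 / ((degOf P.ep t 1 ω : ℝ) * ((degOf P.ep t 1 ω : ℝ) - 1)) * P.joinOne t ω := by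
  have h2 : (2 : ℝ) ≤ degOf P.ep t 1 ω := by exact_mod_cast P.two_le_degOf_one ht ω
  rcases P.joinOne_cases (t := t) ω with h | ⟨h, hd⟩
  · rw [h, mul_zero, sub_zero]
    have : (degOf P.ep t 1 ω : ℝ) ≤ degOf P.ep (t + 1) 1 ω := by
      exact_mod_cast P.degOf_mono 1 ω (Nat.le_succ t)
    exact one_div_le_one_div_of_le (by linarith) (by linarith)
  · have hd' : (degOf P.ep t 1 ω : ℝ) + 1 ≤ degOf P.ep (t + 1) 1 ω := by exact_mod_cast hd
    rw [h]
    set d : ℝ := ((degOf P.ep t 1 ω : ℕ) : ℝ)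
    calc 1 / ((degOf P.ep (t + 1) 1 ω : ℝ) - 1) ≤ 1 / d :=
          one_div_le_one_div_of_le (by linarith) (by linarith)
      _ = 1 / (d - 1) - 1 / (d * (d - 1)) * 1 := by
          have : d ≠ 0 := by linarith
          have : d - 1 ≠ 0 := by linarith
          field_simp

end Deterministic

section Measurability

theorem measurable_degOf (t i : ℕ) : Measurable[P.ℱ t] (degOf P.ep t i) := by
  unfold degOf
  refine Finset.measurable_fun_sum _ fun s hs => ?_
  have h : Measurable[P.ℱ t] (P.ep s) :=
    (P.ep_meas s).mono (P.ℱ.mono (Finset.mem_Icc.1 hs).2) le_rfl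
  exact (measurable_of_countable fun x : ℕ × ℕ =>
    (if x.1 = i then 1 else 0) + (if x.2 = i then 1 else 0)).comp h

theorem measurable_comp_degOf (t i : ℕ) (g : ℕ → ℝ) :
    Measurable[P.ℱ t] fun ω => g (degOf P.ep t i ω) :=
  (measurable_of_countable g).comp (P.measurable_degOf t i)

theorem measurableSet_attachOne (s : ℕ) : MeasurableSet[P.ℱ (s + 1)] (P.attachOne s) := by
  have h1 : MeasurableSet[P.ℱ (s + 1)] {ω | P.Z (s + 1) ω = true} :=
    P.Z_meas (s + 1) (measurableSet_singleton true)
  have h2 : Measurable[P.ℱ (s + 1)] fun ω => (P.ep (s + 1) ω, P.nv s ω) :=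
    (P.ep_meas (s + 1)).prodMk ((P.nv_meas s).mono (P.ℱ.mono (Nat.le_succ s)) le_rfl)
  have h3 : MeasurableSet {x : (ℕ × ℕ) × ℕ | x.1 = (1, x.2 + 1)} :=
    (Set.to_countable _).measurableSet
  exact h1.inter (h2 h3)

theorem measurableSet_edgeEvent (s u w : ℕ) :
    MeasurableSet[P.ℱ (s + 1)] (P.edgeEvent s u w) :=
  (P.Z_meas (s + 1) (measurableSet_singleton false)).inter
    (P.ep_meas (s + 1) (measurableSet_singleton (u, w)))

theorem integral_mul_attachOne {t : ℕ} (ht : 1 ≤ t) {f : P.Ω → ℝ} {C : ℝ}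
    (hf : Measurable[P.ℱ t] f) (hC : ∀ ω, |f ω| ≤ C) :
    ∫ ω, f ω * (P.attachOne t).indicator (fun _ => (1 : ℝ)) ω ∂P.μ =
      ∫ ω, f ω * (p * (degOf P.ep t 1 ω : ℝ) / (2 * t)) ∂P.μ :=
  integral_mul_indicator_of_condExp (P.ℱ.le t) hf hC
    (P.ℱ.le (t + 1) _ (P.measurableSet_attachOne t)) (P.condLaw_vertex t ht 1)

theorem integral_mul_edgeEvent {t : ℕ} (ht : 1 ≤ t) (u w : ℕ) {f : P.Ω → ℝ} {C : ℝ}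
    (hf : Measurable[P.ℱ t] f) (hC : ∀ ω, |f ω| ≤ C) :
    ∫ ω, f ω * (P.edgeEvent t u w).indicator (fun _ => (1 : ℝ)) ω ∂P.μ =
      ∫ ω, f ω * ((1 - p) * (degOf P.ep t u ω : ℝ) * (degOf P.ep t w ω : ℝ) / (2 * t) ^ 2) ∂P.μ :=
  integral_mul_indicator_of_condExp (P.ℱ.le t) hf hC
    (P.ℱ.le (t + 1) _ (P.measurableSet_edgeEvent t u w)) (P.condLaw_edge t ht u w)

theorem integrable_of_abs_le {t : ℕ} {f : P.Ω → ℝ} {C : ℝ} (hf : Measurable[P.ℱ t] f)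
    (hC : ∀ ω, |f ω| ≤ C) : Integrable f P.μ :=
  Integrable.of_bound (hf.mono (P.ℱ.le t) le_rfl).aestronglyMeasurable C
    (Eventually.of_forall fun ω => by simpa using hC ω)

end Measurability

section NegativeMoment

theorem abs_inv_degOf_sub_one_le {t : ℕ} (ht : 1 ≤ t) (ω : P.Ω) :
    |1 / ((degOf P.ep t 1 ω : ℝ) - 1)| ≤ 1 := by
  have h2 : (2 : ℝ) ≤ degOf P.ep t 1 ω := by exact_mod_cast P.two_le_degOf_one ht ω
  rw [abs_of_nonneg (one_div_nonneg.2 (by linarith)), div_le_one (by linarith)]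
  linarith

theorem integrable_inv_degOf_sub_one {t : ℕ} (ht : 1 ≤ t) :
    Integrable (fun ω => 1 / ((degOf P.ep t 1 ω : ℝ) - 1)) P.μ :=
  P.integrable_of_abs_le (P.measurable_comp_degOf t 1 fun n => 1 / ((n : ℝ) - 1))
    (P.abs_inv_degOf_sub_one_le ht)

theorem sum_degOf_Icc_two {t : ℕ} (ht : 1 ≤ t) (ω : P.Ω) :
    ∑ w ∈ Finset.Icc 2 t, (degOf P.ep t w ω : ℝ) = 2 * t - degOf P.ep t 1 ω := by
  have h := P.sum_degOf t ω
  rw [← Finset.add_sum_Ioc_eq_sum_Icc ht] at h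
  have h' : (degOf P.ep t 1 ω : ℝ) + ∑ w ∈ Finset.Ioc 1 t, (degOf P.ep t w ω : ℝ) = 2 * t := by
    exact_mod_cast h
  have h2 : Finset.Icc 2 t = Finset.Ioc 1 t := by ext; simp; omega
  rw [h2]
  linarith

theorem integral_mul_joinOne {t : ℕ} (ht : 1 ≤ t) {f : P.Ω → ℝ} {C : ℝ}
    (hf : Measurable[P.ℱ t] f) (hC : ∀ ω, |f ω| ≤ C) :
    Integrable (fun ω => f ω * P.joinOne t ω) P.μ ∧
    ∫ ω, f ω * P.joinOne t ω ∂P.μ =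
      ∫ ω, f ω * ((1 - p / 2) / t * degOf P.ep t 1 ω -
        (1 - p) * (degOf P.ep t 1 ω : ℝ) ^ 2 / (2 * t ^ 2)) ∂P.μ := by
  have hfi := P.integrable_of_abs_le hf hC
  have hI : ∀ B : Set P.Ω, MeasurableSet[P.ℱ (t + 1)] B →
      Integrable (fun ω => f ω * B.indicator (fun _ => (1 : ℝ)) ω) P.μ := fun B hB =>
    Integrable.bdd_mul ((integrable_const (1 : ℝ)).indicator (P.ℱ.le _ _ hB))
      (hf.mono (P.ℱ.le t) le_rfl).aestronglyMeasurable
      (Eventually.of_forall fun ω => by simpa using hC ω)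
  have hD : ∀ g : P.Ω → ℝ, Measurable[P.ℱ t] g → (∃ K, ∀ ω, |g ω| ≤ K) →
      Integrable (fun ω => f ω * g ω) P.μ := by
    rintro g hg ⟨K, hK⟩
    exact (P.integrable_of_abs_le hg hK).bdd_mul
      (hf.mono (P.ℱ.le t) le_rfl).aestronglyMeasurable
      (Eventually.of_forall fun ω => by simpa using hC ω)
  have hdeg : ∀ (i : ℕ) ω, (degOf P.ep t i ω : ℝ) ≤ 2 * t := fun i ω => by
    exact_mod_cast P.degOf_le t i ω
  have hm : ∀ i, Measurable[P.ℱ t] fun ω => (degOf P.ep t i ω : ℝ) := fun i =>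
    P.measurable_comp_degOf t i fun n => (n : ℝ)
  have hV : Integrable (fun ω => f ω * (p * (degOf P.ep t 1 ω : ℝ) / (2 * t))) P.μ := by
    refine hD _ (((hm 1).const_mul p).div_const _) ⟨|p| * (2 * t) / (2 * t), fun ω => ?_⟩
    rw [abs_div, abs_mul, Nat.abs_cast, abs_of_nonneg (by positivity : (0 : ℝ) ≤ 2 * t)]
    gcongr
    exact hdeg 1 ω
  have hE : ∀ u w, Integrable (fun ω => f ω *
      ((1 - p) * (degOf P.ep t u ω : ℝ) * (degOf P.ep t w ω : ℝ) / (2 * t) ^ 2)) P.μ := by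
    intro u w
    refine hD _ ((((hm u).const_mul (1 - p)).mul (hm w)).div_const _)
      ⟨|1 - p| * (2 * t) * (2 * t) / (2 * t) ^ 2, fun ω => ?_⟩
    rw [abs_div, abs_mul, abs_mul, Nat.abs_cast, Nat.abs_cast,
      abs_of_nonneg (by positivity : (0 : ℝ) ≤ (2 * t) ^ 2)]
    gcongr
    · exact hdeg u ω
    · exact hdeg w ω
  have hV' := hI _ (P.measurableSet_attachOne t)
  have hE' := fun u w => hI _ (P.measurableSet_edgeEvent t u w)
  have hS := integrable_finsetSum (Finset.Icc 2 t) fun w _ => (hE' 1 w).fun_add (hE' w 1)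
  have hexp : (fun ω => f ω * P.joinOne t ω) = fun ω =>
      f ω * (P.attachOne t).indicator (fun _ => (1 : ℝ)) ω +
      ∑ w ∈ Finset.Icc 2 t, (f ω * (P.edgeEvent t 1 w).indicator (fun _ => (1 : ℝ)) ω +
        f ω * (P.edgeEvent t w 1).indicator (fun _ => (1 : ℝ)) ω) := by
    funext ω
    simp only [joinOne, mul_add, Finset.mul_sum]
  rw [hexp]
  refine ⟨hV'.add hS, ?_⟩
  rw [integral_add hV' hS, integral_finsetSum _ fun w _ => (hE' 1 w).fun_add (hE' w 1),
    P.integral_mul_attachOne ht hf hC]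
  have hsum : ∀ w ∈ Finset.Icc 2 t,
      ∫ ω, f ω * (P.edgeEvent t 1 w).indicator (fun _ => (1 : ℝ)) ω +
        f ω * (P.edgeEvent t w 1).indicator (fun _ => (1 : ℝ)) ω ∂P.μ =
      ∫ ω, (f ω * ((1 - p) * (degOf P.ep t 1 ω : ℝ) * (degOf P.ep t w ω : ℝ) / (2 * t) ^ 2) +
        f ω * ((1 - p) * (degOf P.ep t w ω : ℝ) * (degOf P.ep t 1 ω : ℝ) / (2 * t) ^ 2)) ∂P.μ := by
    intro w _
    rw [integral_add (hE' 1 w) (hE' w 1), integral_add (hE 1 w) (hE w 1),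
      P.integral_mul_edgeEvent ht 1 w hf hC, P.integral_mul_edgeEvent ht w 1 hf hC]
  rw [Finset.sum_congr rfl hsum, ← integral_finsetSum _ fun w _ => (hE 1 w).fun_add (hE w 1),
    ← integral_add hV (integrable_finsetSum _ fun w _ => (hE 1 w).fun_add (hE w 1))]
  congr 1
  funext ω
  have ht0 : (t : ℝ) ≠ 0 := by positivity
  have h := P.sum_degOf_Icc_two ht ω
  have h2 : ∑ w ∈ Finset.Icc 2 t,
      (f ω * ((1 - p) * (degOf P.ep t 1 ω : ℝ) * (degOf P.ep t w ω : ℝ) / (2 * t) ^ 2) +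
        f ω * ((1 - p) * (degOf P.ep t w ω : ℝ) * (degOf P.ep t 1 ω : ℝ) / (2 * t) ^ 2)) =
      f ω * (2 * (1 - p) * (degOf P.ep t 1 ω : ℝ) / (2 * t) ^ 2) *
        ∑ w ∈ Finset.Icc 2 t, (degOf P.ep t w ω : ℝ) := by
    rw [Finset.mul_sum]
    exact Finset.sum_congr rfl fun w _ => by ring
  rw [h2, h]
  field_simp
  ring

theorem integral_inv_degOf_succ_le (hp0 : 0 ≤ p) (hp1 : p ≤ 1) {t : ℕ} (ht : 1 ≤ t) :
    ∫ ω, 1 / ((degOf P.ep (t + 1) 1 ω : ℝ) - 1) ∂P.μ ≤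
      (1 - (1 - p / 2) / t) * ∫ ω, 1 / ((degOf P.ep t 1 ω : ℝ) - 1) ∂P.μ + 1 / (t : ℝ) ^ 2 := by
  have hX := P.integrable_inv_degOf_sub_one ht
  have hf := P.measurable_comp_degOf t 1 fun n => 1 / ((n : ℝ) * ((n : ℝ) - 1))
  have h2 : ∀ ω, (2 : ℝ) ≤ degOf P.ep t 1 ω := fun ω => by
    exact_mod_cast P.two_le_degOf_one ht ω
  have hC : ∀ ω, |1 / ((degOf P.ep t 1 ω : ℝ) * ((degOf P.ep t 1 ω : ℝ) - 1))| ≤ 1 := by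
    intro ω
    have := h2 ω
    have h3 : (1 : ℝ) ≤ (degOf P.ep t 1 ω : ℝ) * ((degOf P.ep t 1 ω : ℝ) - 1) := by nlinarith
    rw [abs_of_nonneg (one_div_nonneg.2 (by linarith)), div_le_one (by linarith)]
    exact h3
  obtain ⟨hJi, hJ⟩ := P.integral_mul_joinOne ht hf hC
  have hR : Integrable (fun ω => (1 - p / 2) / t * (1 / ((degOf P.ep t 1 ω : ℝ) - 1)) -
      1 / (t : ℝ) ^ 2) P.μ := (hX.const_mul _).sub (integrable_const _)
  have hlow : ∫ ω, ((1 - p / 2) / t * (1 / ((degOf P.ep t 1 ω : ℝ) - 1)) - 1 / (t : ℝ) ^ 2) ∂P.μ ≤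
      ∫ ω, 1 / ((degOf P.ep t 1 ω : ℝ) * ((degOf P.ep t 1 ω : ℝ) - 1)) * P.joinOne t ω ∂P.μ := by
    rw [hJ]
    refine integral_mono hR (P.integrable_of_abs_le (C := ((1 - p / 2) / t + (1 - p) / t ^ 2))
      (P.measurable_comp_degOf t 1 fun n => 1 / ((n : ℝ) * ((n : ℝ) - 1)) *
        ((1 - p / 2) / t * n - (1 - p) * (n : ℝ) ^ 2 / (2 * t ^ 2))) ?_) ?_
    all_goals
      intro ω
      have hd := h2 ω
      beta_reduce
      generalize ((degOf P.ep t 1 ω : ℕ) : ℝ) = d at hd ⊢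
      have ht0 : (0 : ℝ) < t := by positivity
      have hd1 : 0 < d - 1 := by linarith
      have heq : 1 / (d * (d - 1)) * ((1 - p / 2) / t * d - (1 - p) * d ^ 2 / (2 * t ^ 2)) =
          (1 - p / 2) / t * (1 / (d - 1)) - (1 - p) / t ^ 2 * (d / (2 * (d - 1))) := by
        have : d ≠ 0 := by linarith
        field_simp
      have hb : d / (2 * (d - 1)) ≤ 1 := by rw [div_le_one (by linarith)]; linarith
      have hb0 : 0 ≤ d / (2 * (d - 1)) := by positivity
      have hc : 1 / (d - 1) ≤ 1 := by rw [div_le_one (by linarith)]; linarith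
      have hc0 : 0 ≤ 1 / (d - 1) := by positivity
      have hu : 0 ≤ (1 - p / 2) / t := div_nonneg (by linarith) ht0.le
      have hv : 0 ≤ (1 - p) / (t : ℝ) ^ 2 := div_nonneg (by linarith) (by positivity)
      have hv1 : (1 - p) / (t : ℝ) ^ 2 ≤ 1 / (t : ℝ) ^ 2 := by gcongr; linarith
      rw [heq]
    · rw [abs_le]
      constructor <;> nlinarith [mul_nonneg hu hc0, mul_nonneg hv hb0,
        mul_nonneg hu (sub_nonneg.2 hc), mul_nonneg hv (sub_nonneg.2 hb)]
    · nlinarith [mul_nonneg hv (sub_nonneg.2 hb)]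
  have hstep := integral_mono (P.integrable_inv_degOf_sub_one (Nat.le_succ_of_le ht))
    (hX.sub hJi) fun ω => P.inv_degOf_succ_le ht ω
  simp only [Pi.sub_apply] at hstep
  rw [integral_sub hX hJi] at hstep
  rw [integral_sub (hX.const_mul _) (integrable_const _), integral_const_mul] at hlow
  simp only [integral_const, probReal_univ, one_smul] at hlow
  linarith

end NegativeMoment

end PAProcess

theorem one_sub_div_mul_rpow_neg_le {b t : ℝ} (hb0 : 0 ≤ b) (hb1 : b ≤ 1) (ht : 0 < t) :
    (1 - b / t) * t ^ (-b) ≤ (t + 1) ^ (-b) := by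
  have h : (1 + 1 / t) ^ b ≤ 1 + b * (1 / t) :=
    rpow_one_add_le_one_add_mul_self (by have : 0 < 1 / t := by positivity
                                         linarith) hb0 hb1
  have hsplit : (t + 1) ^ b = t ^ b * (1 + 1 / t) ^ b := by
    rw [← Real.mul_rpow ht.le (by positivity)]
    congr 1
    field_simp
  rw [Real.rpow_neg ht.le, Real.rpow_neg (by linarith), hsplit, mul_inv, mul_comm]
  have hpos : 0 < (1 + 1 / t) ^ b := by positivity
  gcongr
  rw [inv_eq_one_div, le_div_iff₀ hpos]
  rcases le_total (1 - b / t) 0 with h1 | h1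
  · nlinarith
  · have h2 : (1 - b / t) * (1 + 1 / t) ^ b ≤ (1 - b / t) * (1 + b * (1 / t)) := by gcongr
    refine h2.trans ?_
    have h3 : (1 - b / t) * (1 + b * (1 / t)) = 1 - (b / t) ^ 2 := by ring
    rw [h3]
    nlinarith [sq_nonneg (b / t)]

namespace PAProcess

attribute [local instance] PAProcess.m0 PAProcess.isProb

variable {p : ℝ} (P : PAProcess p)

theorem integral_inv_degOf_le (hp0 : 0 ≤ p) (hp1 : p ≤ 1) {b : ℝ} (hb0 : 0 ≤ b)
    (hb : b < 1 - p / 2) {t : ℕ} (ht : 1 ≤ t) :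
    ∫ ω, 1 / ((degOf P.ep t 1 ω : ℝ) - 1) ∂P.μ ≤
      (1 + 1 / (1 - p / 2 - b)) * (t : ℝ) ^ (-b) := by
  have hcb : 0 < 1 - p / 2 - b := by linarith
  induction t, ht using Nat.le_induction with
  | base =>
    have h1 : ∫ ω, 1 / ((degOf P.ep 1 1 ω : ℝ) - 1) ∂P.μ ≤ ∫ _, (1 : ℝ) ∂P.μ :=
      integral_mono (P.integrable_inv_degOf_sub_one le_rfl) (integrable_const _) fun ω =>
        (le_abs_self _).trans (P.abs_inv_degOf_sub_one_le le_rfl ω)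
    have h2 : 0 ≤ 1 / (1 - p / 2 - b) := by positivity
    simp only [integral_const, probReal_univ, one_smul] at h1
    rw [Nat.cast_one, Real.one_rpow]
    linarith
  | succ t ht ih =>
    have ht1 : (1 : ℝ) ≤ t := by exact_mod_cast ht
    have ht0 : (0 : ℝ) < t := by linarith
    have hc0 : 0 ≤ 1 - (1 - p / 2) / t := by
      rw [sub_nonneg, div_le_one ht0]; linarith
    set K : ℝ := 1 + 1 / (1 - p / 2 - b) with hK
    have hK1 : 1 ≤ K * (1 - p / 2 - b) := by
      rw [hK, add_mul, one_div_mul_cancel hcb.ne']; linarith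
    have hK0 : 0 ≤ K := by positivity
    have hpow : 1 / (t : ℝ) ≤ (t : ℝ) ^ (-b) := by
      rw [one_div, ← Real.rpow_neg_one]
      exact Real.rpow_le_rpow_of_exponent_le ht1 (by linarith)
    have herr : 1 / (t : ℝ) ^ 2 ≤ K * ((1 - p / 2 - b) / t) * (t : ℝ) ^ (-b) := by
      calc 1 / (t : ℝ) ^ 2 = 1 / t * (1 / t) := by field_simp
        _ ≤ (K * (1 - p / 2 - b)) / t * (t : ℝ) ^ (-b) := by gcongr
        _ = _ := by ring
    calc ∫ ω, 1 / ((degOf P.ep (t + 1) 1 ω : ℝ) - 1) ∂P.μ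
        ≤ (1 - (1 - p / 2) / t) * (K * (t : ℝ) ^ (-b)) + 1 / (t : ℝ) ^ 2 :=
          (P.integral_inv_degOf_succ_le hp0 hp1 ht).trans (by gcongr)
      _ ≤ (1 - (1 - p / 2) / t) * (K * (t : ℝ) ^ (-b)) +
          K * ((1 - p / 2 - b) / t) * (t : ℝ) ^ (-b) := by gcongr
      _ = K * ((1 - b / t) * (t : ℝ) ^ (-b)) := by ring
      _ ≤ K * ((t : ℝ) + 1) ^ (-b) := by
          gcongr
          exact one_sub_div_mul_rpow_neg_le hb0 (by linarith) ht0
      _ = K * ((t + 1 : ℕ) : ℝ) ^ (-b) := by push_cast; rfl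

section Concentration

/-- The compensator of `attachCount`. -/
noncomputable def attachDrift (t : ℕ) (ω : P.Ω) : ℝ :=
  ∑ s ∈ Finset.Ico 1 t, p * (degOf P.ep s 1 ω : ℝ) / (2 * s)

theorem attachDrift_succ {t : ℕ} (ht : 1 ≤ t) (ω : P.Ω) : P.attachDrift (t + 1) ω =
    P.attachDrift t ω + p * (degOf P.ep t 1 ω : ℝ) / (2 * t) :=
  Finset.sum_Ico_succ_top ht _

theorem attachCount_succ {t : ℕ} (ht : 1 ≤ t) (ω : P.Ω) : P.attachCount (t + 1) ω =
    P.attachCount t ω + (P.attachOne t).indicator (fun _ => (1 : ℝ)) ω :=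
  Finset.sum_Ico_succ_top ht _

theorem attachCount_nonneg (t : ℕ) (ω : P.Ω) : 0 ≤ P.attachCount t ω :=
  Finset.sum_nonneg fun _ _ => Set.indicator_nonneg (fun _ _ => zero_le_one) _

theorem attachDrift_le (hp1 : p ≤ 1) (t : ℕ) (ω : P.Ω) :
    P.attachDrift t ω ≤ t := by
  calc P.attachDrift t ω ≤ ∑ _s ∈ Finset.Ico 1 t, (1 : ℝ) := by
        refine Finset.sum_le_sum fun s hs => ?_
        have hs1 : (1 : ℝ) ≤ s := by exact_mod_cast (Finset.mem_Ico.1 hs).1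
        have hd : (degOf P.ep s 1 ω : ℝ) ≤ 2 * s := by exact_mod_cast P.degOf_le s 1 ω
        rw [div_le_one (by linarith)]
        nlinarith [Nat.cast_nonneg (α := ℝ) (degOf P.ep s 1 ω)]
    _ ≤ t := by simp

theorem measurable_attachDrift (t : ℕ) : Measurable[P.ℱ t] (P.attachDrift t) :=
  Finset.measurable_fun_sum _ fun s hs =>
    (P.measurable_comp_degOf s 1 fun n => p * (n : ℝ) / (2 * s)).mono
      (P.ℱ.mono (Finset.mem_Ico.1 hs).2.le) le_rfl

theorem measurable_attachCount (t : ℕ) : Measurable[P.ℱ t] (P.attachCount t) :=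
  Finset.measurable_fun_sum _ fun s hs =>
    measurable_const.indicator
      (P.ℱ.mono (Finset.mem_Ico.1 hs).2 _ (P.measurableSet_attachOne s))

theorem measurable_exp_attach (t : ℕ) :
    Measurable[P.ℱ t] fun ω => Real.exp (P.attachDrift t ω / 2 - P.attachCount t ω) :=
  Real.measurable_exp.comp
    (((P.measurable_attachDrift t).div_const 2).sub (P.measurable_attachCount t))

theorem abs_exp_attach_le (hp1 : p ≤ 1) (t : ℕ) (ω : P.Ω) :
    |Real.exp (P.attachDrift t ω / 2 - P.attachCount t ω)| ≤ Real.exp t := by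
  rw [Real.abs_exp, Real.exp_le_exp]
  have := P.attachDrift_le hp1 t ω
  have := P.attachCount_nonneg t ω
  have : (0 : ℝ) ≤ t := Nat.cast_nonneg t
  linarith

theorem integrable_exp_attach (hp1 : p ≤ 1) (t : ℕ) :
    Integrable (fun ω => Real.exp (P.attachDrift t ω / 2 - P.attachCount t ω)) P.μ :=
  P.integrable_of_abs_le (P.measurable_exp_attach t) (P.abs_exp_attach_le hp1 t)

theorem integral_exp_attach_le_one (hp0 : 0 ≤ p) (hp1 : p ≤ 1) {t : ℕ} (ht : 1 ≤ t) :
    ∫ ω, Real.exp (P.attachDrift t ω / 2 - P.attachCount t ω) ∂P.μ ≤ 1 := by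
  induction t, ht using Nat.le_induction with
  | base => simp [attachDrift, attachCount]
  | succ t ht ih =>
    refine le_trans ?_ ih
    set g : P.Ω → ℝ := fun ω => Real.exp (P.attachDrift (t + 1) ω / 2 - P.attachCount t ω) with hg
    have hgm : Measurable[P.ℱ t] g := by
      have h : g = fun ω => Real.exp ((P.attachDrift t ω +
          p * (degOf P.ep t 1 ω : ℝ) / (2 * t)) / 2 - P.attachCount t ω) := by
        funext ω
        rw [hg, ← P.attachDrift_succ ht]
      rw [h]
      exact Real.measurable_exp.comp ((((P.measurable_attachDrift t).add
        (P.measurable_comp_degOf t 1 fun n => p * (n : ℝ) / (2 * t))).div_const 2).sub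
        (P.measurable_attachCount t))
    have hgC : ∀ ω, |g ω| ≤ Real.exp ((t + 1 : ℕ) : ℝ) := by
      intro ω
      rw [hg, Real.abs_exp, Real.exp_le_exp]
      have := P.attachDrift_le hp1 (t + 1) ω
      have := P.attachCount_nonneg t ω
      have : (0 : ℝ) ≤ ((t + 1 : ℕ) : ℝ) := Nat.cast_nonneg _
      linarith
    have hgi := P.integrable_of_abs_le hgm hgC
    have hB := P.ℱ.le _ _ (P.measurableSet_attachOne t)
    have hgV : Integrable (fun ω => g ω * (P.attachOne t).indicator (fun _ => (1 : ℝ)) ω) P.μ :=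
      Integrable.bdd_mul ((integrable_const (1 : ℝ)).indicator hB)
        (hgm.mono (P.ℱ.le t) le_rfl).aestronglyMeasurable
        (Eventually.of_forall fun ω => by simpa using hgC ω)
    have hgq : Integrable (fun ω => g ω * (p * (degOf P.ep t 1 ω : ℝ) / (2 * t))) P.μ := by
      refine (P.integrable_of_abs_le (C := 1)
        (P.measurable_comp_degOf t 1 fun n => p * (n : ℝ) / (2 * t)) fun ω => ?_).bdd_mul
        (hgm.mono (P.ℱ.le t) le_rfl).aestronglyMeasurable
        (Eventually.of_forall fun ω => by simpa using hgC ω)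
      have hd : (degOf P.ep t 1 ω : ℝ) ≤ 2 * t := by exact_mod_cast P.degOf_le t 1 ω
      have ht0 : (0 : ℝ) < t := by exact_mod_cast ht
      rw [abs_of_nonneg (by positivity), div_le_one (by linarith)]
      nlinarith [Nat.cast_nonneg (α := ℝ) (degOf P.ep t 1 ω)]
    calc ∫ ω, Real.exp (P.attachDrift (t + 1) ω / 2 - P.attachCount (t + 1) ω) ∂P.μ
        ≤ ∫ ω, (g ω - 1 / 2 * (g ω * (P.attachOne t).indicator (fun _ => (1 : ℝ)) ω)) ∂P.μ := by
          refine integral_mono (P.integrable_exp_attach hp1 (t + 1))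
            (hgi.sub (hgV.const_mul _)) fun ω => ?_
          simp only [P.attachCount_succ ht, hg]
          by_cases hω : ω ∈ P.attachOne t
          · rw [Set.indicator_of_mem hω, ← sub_sub, Real.exp_sub _ 1]
            have he : (2 : ℝ) ≤ Real.exp 1 := by linarith [Real.add_one_le_exp 1]
            have : Real.exp (P.attachDrift (t + 1) ω / 2 - P.attachCount t ω) / Real.exp 1 ≤
                Real.exp (P.attachDrift (t + 1) ω / 2 - P.attachCount t ω) / 2 := by gcongr
            linarith
          · simp [Set.indicator_of_notMem hω]
      _ = ∫ ω, (g ω - 1 / 2 * (g ω * (p * (degOf P.ep t 1 ω : ℝ) / (2 * t)))) ∂P.μ := by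
          rw [integral_sub hgi (hgV.const_mul _), integral_sub hgi (hgq.const_mul _),
            integral_const_mul, integral_const_mul, P.integral_mul_attachOne ht hgm hgC]
      _ ≤ ∫ ω, Real.exp (P.attachDrift t ω / 2 - P.attachCount t ω) ∂P.μ := by
          refine integral_mono (hgi.sub (hgq.const_mul _))
            (P.integrable_exp_attach hp1 t) fun ω => ?_
          simp only [hg, P.attachDrift_succ ht]
          set q : ℝ := p * (degOf P.ep t 1 ω : ℝ) / (2 * t)
          rw [show (P.attachDrift t ω + q) / 2 - P.attachCount t ω =
            (P.attachDrift t ω / 2 - P.attachCount t ω) + q / 2 by ring, Real.exp_add]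
          set Y : ℝ := Real.exp (P.attachDrift t ω / 2 - P.attachCount t ω)
          have h1 : 1 - q / 2 ≤ Real.exp (-(q / 2)) := Real.one_sub_le_exp_neg _
          calc Y * Real.exp (q / 2) - 1 / 2 * (Y * Real.exp (q / 2) * q)
              = Y * Real.exp (q / 2) * (1 - q / 2) := by ring
            _ ≤ Y * Real.exp (q / 2) * Real.exp (-(q / 2)) := by gcongr
            _ = Y := by rw [mul_assoc, ← Real.exp_add, add_neg_cancel, Real.exp_zero, mul_one]

theorem le_attachDrift (hp0 : 0 ≤ p) {t : ℕ} (ht : 2 ≤ t) (ω : P.Ω) :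
    p / 4 * degOf P.ep (t / 2) 1 ω ≤ P.attachDrift t ω := by
  have ht0 : (0 : ℝ) < t := by positivity
  calc p / 4 * degOf P.ep (t / 2) 1 ω
      = (t / 2 : ℝ) * (p * (degOf P.ep (t / 2) 1 ω : ℝ) / (2 * t)) := by field_simp; ring
    _ ≤ ((t - t / 2 : ℕ) : ℝ) * (p * (degOf P.ep (t / 2) 1 ω : ℝ) / (2 * t)) := by
        gcongr
        rw [div_le_iff₀ two_pos]
        exact_mod_cast (by omega : t ≤ (t - t / 2) * 2)
    _ = ∑ _s ∈ Finset.Ico (t / 2) t, p * (degOf P.ep (t / 2) 1 ω : ℝ) / (2 * t) := by simp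
    _ ≤ ∑ s ∈ Finset.Ico (t / 2) t, p * (degOf P.ep s 1 ω : ℝ) / (2 * s) := by
        refine Finset.sum_le_sum fun s hs => ?_
        rw [Finset.mem_Ico] at hs
        have hs0 : (0 : ℝ) < s := by exact_mod_cast (by omega : 0 < s)
        have hst : (s : ℝ) ≤ t := by exact_mod_cast hs.2.le
        have hd : (degOf P.ep (t / 2) 1 ω : ℝ) ≤ degOf P.ep s 1 ω := by
          exact_mod_cast P.degOf_mono 1 ω hs.1
        gcongr
    _ ≤ P.attachDrift t ω := by
        refine Finset.sum_le_sum_of_subset_of_nonneg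
          (Finset.Ico_subset_Ico (by omega) le_rfl) fun s _ _ => by positivity

theorem measureReal_degOf_small_le (hp0 : 0 ≤ p) (hp1 : p ≤ 1) {b γ : ℝ} (hb0 : 0 ≤ b)
    (hb : b < 1 - p / 2) {t : ℕ} (ht : 1 ≤ t) :
    P.μ.real {ω | (t : ℝ) ^ (-γ) ≤ 1 / ((degOf P.ep t 1 ω : ℝ) - 1)} ≤
      (1 + 1 / (1 - p / 2 - b)) * (t : ℝ) ^ (γ - b) := by
  have ht0 : (0 : ℝ) < t := by exact_mod_cast ht
  have h := mul_meas_ge_le_integral_of_nonneg (μ := P.μ)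
    (Eventually.of_forall fun ω => ?_) (P.integrable_inv_degOf_sub_one ht) ((t : ℝ) ^ (-γ))
  · have h2 := h.trans (P.integral_inv_degOf_le hp0 hp1 hb0 hb ht)
    rw [mul_comm, ← le_div_iff₀ (by positivity)] at h2
    refine h2.trans_eq ?_
    rw [mul_div_assoc, ← Real.rpow_sub ht0]
    ring_nf
  · have h2 : (2 : ℝ) ≤ degOf P.ep t 1 ω := by exact_mod_cast P.two_le_degOf_one ht ω
    exact one_div_nonneg.2 (by linarith)

theorem measureReal_attachCount_small_le (hp0 : 0 ≤ p) (hp1 : p ≤ 1) {t : ℕ} (ht : 1 ≤ t)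
    (x : ℝ) :
    P.μ.real {ω | x ≤ P.attachDrift t ω / 2 - P.attachCount t ω} ≤ Real.exp (-x) := by
  have h := mul_meas_ge_le_integral_of_nonneg (μ := P.μ)
    (Eventually.of_forall fun ω => (Real.exp_pos _).le) (P.integrable_exp_attach hp1 t)
    (Real.exp x)
  simp only [Real.exp_le_exp] at h
  rw [Real.exp_neg, ← one_div, le_div_iff₀ (Real.exp_pos x), mul_comm]
  exact h.trans (P.integral_exp_attach_le_one hp0 hp1 ht)

theorem le_nbrCount_of_notMem (hp0 : 0 ≤ p) {γ : ℝ} (hγ0 : 0 ≤ γ) (hγ1 : γ ≤ 1) {t : ℕ}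
    (ht : 2 ≤ t) {ω : P.Ω}
    (h1 : 1 / ((degOf P.ep (t / 2) 1 ω : ℝ) - 1) < ((t / 2 : ℕ) : ℝ) ^ (-γ))
    (h2 : P.attachDrift t ω / 2 - P.attachCount t ω < p / 48 * (t : ℝ) ^ γ) :
    p / 48 * (t : ℝ) ^ γ ≤ P.nbrCount t 1 ω := by
  have hd : (2 : ℝ) ≤ degOf P.ep (t / 2) 1 ω := by
    exact_mod_cast P.two_le_degOf_one (by omega) ω
  have hh : (0 : ℝ) < ((t / 2 : ℕ) : ℝ) := by exact_mod_cast (by omega : 0 < t / 2)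
  have hth : (t : ℝ) / 3 ≤ ((t / 2 : ℕ) : ℝ) := by
    rw [div_le_iff₀ (by norm_num)]
    exact_mod_cast (by omega : t ≤ t / 2 * 3)
  rw [Real.rpow_neg hh.le, one_div, inv_lt_inv₀ (by linarith) (by positivity)] at h1
  have h3 : (t : ℝ) ^ γ / 3 ≤ ((t / 2 : ℕ) : ℝ) ^ γ := by
    calc (t : ℝ) ^ γ / 3 ≤ (t : ℝ) ^ γ / 3 ^ γ := by
          gcongr
          exact (Real.rpow_le_rpow_of_exponent_le (by norm_num) hγ1).trans_eq (Real.rpow_one 3)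
      _ = ((t : ℝ) / 3) ^ γ := (Real.div_rpow (by positivity) (by norm_num) γ).symm
      _ ≤ _ := by gcongr
  have h4 : p / 4 * ((t : ℝ) ^ γ / 3) ≤ P.attachDrift t ω :=
    le_trans (by gcongr; linarith) (P.le_attachDrift hp0 ht ω)
  have h5 := P.attachCount_le_nbrCount t ω
  linarith

end Concentration

end PAProcess

/-- **Lemma (existence of a vertex with many distinct neighbors).**
For `p ∈ (0,1)`, `c_p = 1 - p/2` and every `ε > 0` there are positive constants
`C₁', C₂', δ'` (depending only on `ε` and `p`) such that for all `t ≥ 1`,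
`P(∃ j ∈ G_t, Γ_t(j) ≥ C₁' t^{c_p(1-ε)}) ≥ 1 - C₂' t^{-δ'}`. -/
theorem exists_vertex_many_neighbors (p : ℝ) (hp0 : 0 < p) (hp1 : p < 1)
    (P : PAProcess p) (ε : ℝ) (hε : 0 < ε) :
    ∃ C₁' C₂' δ' : ℝ, 0 < C₁' ∧ 0 < C₂' ∧ 0 < δ' ∧
      ∀ t : ℕ, 1 ≤ t →
        1 - C₂' * (t : ℝ) ^ (-δ') ≤
          (P.μ {ω | ∃ j : ℕ, 1 ≤ j ∧ j ≤ P.nv t ω ∧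
            C₁' * (t : ℝ) ^ ((1 - p / 2) * (1 - ε)) ≤ (P.nbrCount t j ω : ℝ)}).toReal := by
  have := P.isProb
  set c : ℝ := 1 - p / 2 with hc
  have hc0 : 0 < c := by rw [hc]; linarith
  have hc1 : c ≤ 1 := by rw [hc]; linarith
  set e : ℝ := min ε (1 / 2)
  have he0 : 0 < e := lt_min hε (by norm_num)
  have he1 : e ≤ 1 / 2 := min_le_right _ _
  have heε : e ≤ ε := min_le_left _ _
  set γ : ℝ := c * (1 - e) with hγ
  set b : ℝ := c * (1 - e / 2) with hb
  have hγ0 : 0 < γ := mul_pos hc0 (by linarith)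
  have hγ1 : γ ≤ 1 := by nlinarith
  have hb0 : 0 ≤ b := mul_nonneg hc0.le (by linarith)
  have hbc : b < c := by nlinarith
  set K : ℝ := 1 + 1 / (c - b)
  have hK : 1 ≤ K := le_add_of_nonneg_right (one_div_nonneg.2 (by linarith))
  set η : ℝ := c * e / 2 with hη
  have hη0 : 0 < η := by positivity
  have hη1 : η ≤ 1 := by nlinarith
  have hηγ : η ≤ γ := by nlinarith
  have hγb : γ - b = -η := by rw [hγ, hb, hη]; ring
  refine ⟨p / 48, 3 * K + 48 / p, η, by positivity, by positivity, hη0, fun t ht => ?_⟩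
  obtain rfl | ht2 := ht.eq_or_lt
  · have : 0 ≤ 48 / p := by positivity
    refine le_trans ?_ ENNReal.toReal_nonneg
    rw [Nat.cast_one, Real.one_rpow]
    linarith
  have ht1 : (1 : ℝ) ≤ t := by exact_mod_cast ht
  have ht0 : (0 : ℝ) < t := by linarith
  set G := {ω | ∃ j : ℕ, 1 ≤ j ∧ j ≤ P.nv t ω ∧
    p / 48 * (t : ℝ) ^ (c * (1 - ε)) ≤ (P.nbrCount t j ω : ℝ)}
  set B₁ := {ω | ((t / 2 : ℕ) : ℝ) ^ (-γ) ≤ 1 / ((degOf P.ep (t / 2) 1 ω : ℝ) - 1)}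
  set B₂ := {ω | p / 48 * (t : ℝ) ^ γ ≤ P.attachDrift t ω / 2 - P.attachCount t ω}
  have hcover : Set.univ ⊆ G ∪ (B₁ ∪ B₂) := by
    intro ω _
    by_contra hω
    simp only [Set.mem_union, not_or] at hω
    obtain ⟨hG, h1, h2⟩ := hω
    refine hG ⟨1, le_rfl, P.one_le_nv ht ω, le_trans ?_
      (P.le_nbrCount_of_notMem hp0.le hγ0.le hγ1 ht2 (not_le.1 h1) (not_le.1 h2))⟩
    gcongr p / 48 * ?_
    exact Real.rpow_le_rpow_of_exponent_le ht1 (mul_le_mul_of_nonneg_left (by linarith) hc0.le)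
  have hB₁ : P.μ.real B₁ ≤ 3 * K * (t : ℝ) ^ (-η) := by
    refine (P.measureReal_degOf_small_le hp0.le hp1.le hb0 hbc (by omega)).trans ?_
    rw [hγb]
    have hth : (t : ℝ) / 3 ≤ ((t / 2 : ℕ) : ℝ) := by
      rw [div_le_iff₀ (by norm_num)]
      exact_mod_cast (by omega : t ≤ t / 2 * 3)
    calc K * ((t / 2 : ℕ) : ℝ) ^ (-η) ≤ K * ((t : ℝ) / 3) ^ (-η) := by
          gcongr K * ?_
          exact Real.rpow_le_rpow_of_nonpos (by positivity) hth (by linarith)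
      _ = K * ((3 : ℝ) ^ η * (t : ℝ) ^ (-η)) := by
          rw [Real.div_rpow ht0.le (by norm_num), Real.rpow_neg (by norm_num : (0 : ℝ) ≤ 3),
            div_inv_eq_mul, mul_comm (3 ^ η)]
      _ ≤ K * (3 * (t : ℝ) ^ (-η)) := by
          gcongr
          exact (Real.rpow_le_rpow_of_exponent_le (by norm_num) hη1).trans_eq (Real.rpow_one 3)
      _ = _ := by ring
  have hB₂ : P.μ.real B₂ ≤ 48 / p * (t : ℝ) ^ (-η) := by
    refine (P.measureReal_attachCount_small_le hp0.le hp1.le ht _).trans ?_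
    set x : ℝ := p / 48 * (t : ℝ) ^ γ with hx
    have hx0 : 0 < x := by positivity
    calc Real.exp (-x) ≤ x⁻¹ := by
          rw [Real.exp_neg]
          gcongr
          linarith [Real.add_one_le_exp x]
      _ = 48 / p * (t : ℝ) ^ (-γ) := by rw [hx, mul_inv, inv_div, Real.rpow_neg ht0.le]
      _ ≤ 48 / p * (t : ℝ) ^ (-η) := by
          gcongr
  have hone : (1 : ℝ) ≤ P.μ.real G + (P.μ.real B₁ + P.μ.real B₂) :=
    calc (1 : ℝ) = P.μ.real Set.univ := probReal_univ.symm
      _ ≤ P.μ.real (G ∪ (B₁ ∪ B₂)) := measureReal_mono hcover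
      _ ≤ P.μ.real G + P.μ.real (B₁ ∪ B₂) := measureReal_union_le _ _
      _ ≤ _ := by gcongr; exact measureReal_union_le _ _
  change _ ≤ P.μ.real G
  linarith
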